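/- Let G = (V, E) be a finite simple undirected graph with two distinguished distinct vertices r and s, let q ≥ 1 be an integer, and let G_q be the graph obtained from G by replacing each edge {u,v} ∈ E by q internally disjoint paths of length 2 through fresh intermediate vertices w_{u,v,1}, …, w_{u,v,q} (so the edges of G_q are {u, w_{u,v,i}} and {w_{u,v,i}, v} for {u,v} ∈ E and 1 ≤ i ≤ q). Consider a possible world of G_q given by a set V' ⊆ V of kept original vertices, a set W of kept intermediate vertices, and a set E' of kept edges of G_q; call it valid if for every edge {u,v} ∈ E there exists i with w_{u,v,i} ∈ W and both {u, w_{u,v,i}} ∈ E' and {w_{u,v,i}, v} ∈ E'. Then, if the possible world is valid, r and s are connected in the kept subgraph of G_q (whose vertices are V' ∪ W and whose edges are the edges of E' with both endpoints kept) if and only if r and s are connected in the subgraph of G induced on V'. -/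

import Mathlib

namespace URGraph

/-- The graph `G_q` obtained from `G` by replacing each edge `e = {u,v}` of `G` by `q`
internally disjoint paths of length 2 through fresh intermediate vertices `w_{e,1}, …, w_{e,q}`
(represented as `Sum.inr (e, i)`): its edges are exactly the pairs `{u, w_{e,i}}` for `u ∈ e`.  -/
def subdiv {V : Type} (G : SimpleGraph V) (q : ℕ) :
    SimpleGraph (V ⊕ (G.edgeSet × Fin q)) where
  Adj a b :=
    (∃ (u : V) (e : G.edgeSet) (i : Fin q),
        a = Sum.inl u ∧ b = Sum.inr (e, i) ∧ u ∈ (e : Sym2 V)) ∨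
    (∃ (u : V) (e : G.edgeSet) (i : Fin q),
        b = Sum.inl u ∧ a = Sum.inr (e, i) ∧ u ∈ (e : Sym2 V))
  symm := ⟨fun a b h => Or.symm h⟩
  loopless := by
    constructor
    rintro a (⟨u, e, i, rfl, h2, -⟩ | ⟨u, e, i, rfl, h2, -⟩) <;> simp at h2

/-- The kept subgraph of a graph `H`, given a set `X` of kept vertices and a set `E'` of kept
edges: its vertices are those of `X` and its edges are the edges of `H` that belong to `E'`
and have both endpoints kept. -/
def keptSubgraph {W : Type} (H : SimpleGraph W) (X : Set W) (E' : Set (Sym2 W)) :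
    SimpleGraph W where
  Adj a b := H.Adj a b ∧ s(a, b) ∈ E' ∧ a ∈ X ∧ b ∈ X
  symm := by
    constructor
    intro a b ⟨h1, h2, h3, h4⟩
    exact ⟨h1.symm, by rwa [Sym2.eq_swap], h4, h3⟩
  loopless := ⟨fun a h => H.loopless.irrefl a h.1⟩

/-- The subgraph of `H` induced on a vertex set `X` (with the vertices outside `X` kept as
isolated vertices, so that reachability makes sense on the original vertex type): two vertices
are adjacent iff they are adjacent in `H` and both belong to `X`. -/
def inducedOn {W : Type} (H : SimpleGraph W) (X : Set W) : SimpleGraph W where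
  Adj a b := H.Adj a b ∧ a ∈ X ∧ b ∈ X
  symm := ⟨fun a b ⟨h1, h2, h3⟩ => ⟨h1.symm, h3, h2⟩⟩
  loopless := ⟨fun a h => H.loopless.irrefl a h.1⟩

/-- consider a possible world of `G_q` given by kept original vertices
`V' ⊆ V`, kept intermediate vertices `W'`, and kept edges `E'` of `G_q`; it is valid if for
every edge `e` of `G` some intermediate vertex `w_{e,i}` is kept together with both edges
linking it to the endpoints of `e`. If the possible world is valid, then `r` and `s` are
connected in the kept subgraph of `G_q` iff `r` and `s` are connected in the subgraph of `G`
induced on `V'`. -/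
theorem subdiv_connectivity {V : Type} [Fintype V] [DecidableEq V] (G : SimpleGraph V)
    (r s : V) (hrs : r ≠ s) (q : ℕ) (hq : 1 ≤ q)
    (V' : Set V) (W' : Set (G.edgeSet × Fin q)) (E' : Set (Sym2 (V ⊕ (G.edgeSet × Fin q))))
    (hE' : E' ⊆ (subdiv G q).edgeSet)
    (valid : ∀ e : G.edgeSet, ∃ i : Fin q, (e, i) ∈ W' ∧
      ∀ u : V, u ∈ (e : Sym2 V) → s(Sum.inl u, Sum.inr (e, i)) ∈ E') :
    (keptSubgraph (subdiv G q) (Sum.inl '' V' ∪ Sum.inr '' W') E').Reachable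
        (Sum.inl r) (Sum.inl s) ↔
    (inducedOn G V').Reachable r s := by
  rw [SimpleGraph.reachable_iff_reflTransGen]
  constructor
  · intro h
    have key : ∀ x, Relation.ReflTransGen
        (keptSubgraph (subdiv G q) (Sum.inl '' V' ∪ Sum.inr '' W') E').Adj (Sum.inl r) x →
        (∀ v, x = Sum.inl v → (inducedOn G V').Reachable r v) ∧
        (∀ e i, x = Sum.inr (e, i) →
          ∀ u, u ∈ (e : Sym2 V) → u ∈ V' → (inducedOn G V').Reachable r u) := by
      intro x hx
      induction hx with
      | refl =>
        refine ⟨fun v hv => ?_, fun e i h => by simp at h⟩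
        cases hv
        exact SimpleGraph.Reachable.refl _
      | tail _ hadj ih =>
        obtain ⟨hs, -, ha, hb⟩ := hadj
        rcases hs with ⟨u, e, i, rfl, rfl, hu⟩ | ⟨u, e, i, rfl, rfl, hu⟩
        · refine ⟨fun v hv => by simp at hv, fun e' i' h' u' hu' hV => ?_⟩
          cases h'
          have h1 := ih.1 u rfl
          have huV : u ∈ V' := by simpa using ha
          by_cases huu : u = u'
          · exact huu ▸ h1
          · have he : (e : Sym2 V) = s(u, u') := (Sym2.mem_and_mem_iff huu).1 ⟨hu, hu'⟩
            have hG : G.Adj u u' := by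
              have := e.2
              rw [he] at this
              exact this
            have hA : (inducedOn G V').Adj u u' := ⟨hG, huV, hV⟩
            exact h1.trans hA.reachable
        · refine ⟨fun v hv => ?_, fun e' i' h' => by simp at h'⟩
          cases hv
          exact ih.2 e i rfl u hu (by simpa using hb)
    exact (key _ h).1 s rfl
  · intro h
    rw [SimpleGraph.reachable_iff_reflTransGen] at h
    rw [← SimpleGraph.reachable_iff_reflTransGen]
    clear hrs
    induction h with
    | refl => exact SimpleGraph.Reachable.refl _
    | @tail b c _ hadj ih =>
      obtain ⟨hG, hb, hc⟩ := hadj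
      obtain ⟨i, hW, hE⟩ := valid ⟨s(b, c), hG⟩
      have step : ∀ u, u ∈ s(b, c) → u ∈ V' →
          (keptSubgraph (subdiv G q) (Sum.inl '' V' ∪ Sum.inr '' W') E').Adj
            (Sum.inl u) (Sum.inr (⟨s(b, c), hG⟩, i)) := fun u hu hV =>
        ⟨Or.inl ⟨u, _, i, rfl, rfl, hu⟩, hE u hu, Or.inl ⟨u, hV, rfl⟩, Or.inr ⟨_, hW, rfl⟩⟩
      exact (ih.trans (step b (by simp) hb).reachable).trans (step c (by simp) hc).symm.reachable

end URGraph
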